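/- For k ≥ 2 define s_j, c_i ∈ End_{q-Web↑}(↑_1^k) (1 ≤ j ≤ k−1, 1 ≤ i ≤ k) as follows: c_i is the dot on the i-th 1-strand, and s_j acts on the j-th and (j+1)-st strands by split_{1,1} ∘ merge_{1,1} − id. Then for all admissible i, j: (1) s_j^2 = id; (2) s_i s_j = s_j s_i if |i−j| > 1; (3) s_i s_{i+1} s_i = s_{i+1} s_i s_{i+1}; (4) s_i c_j = c_j s_i if |i−j| > 1; (5) s_i c_i = c_{i+1} s_i. -/

import Mathlib

noncomputable section

/-- Objects of the web category `q-Web↑`: words of nonnegative integers. -/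
abbrev WObj := List ℕ

/-- A model of the strict monoidal supercategory `q-Web↑` of Brown–Kujawa
(Definition 4.1 of "Webs of type Q"): a ℂ-linear supercategory with objects the
words of nonnegative integers, tensor product given by concatenation of words,
generating morphisms the (odd) dots, (even) merges and (even) splits, subject
to the defining web relations (associativity and coassociativity, digon
removal, dot collision, dots past merges/splits, the dumbbell relation and the
square switch relation), together with the `ℤ/2`-grading (parity) data making
it a supercategory with the super-interchange law. -/
structure QWebUp where
  Hom : WObj → WObj → ModuleCat.{0} ℂ
  id : ∀ a : WObj, Hom a a
  comp : ∀ {a b c : WObj}, Hom a b → Hom b c → Hom a c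
  tensor : ∀ {a b a' b' : WObj}, Hom a b → Hom a' b' → Hom (a ++ a') (b ++ b')
  dot : ∀ k : ℕ, Hom [k] [k]
  merge : ∀ k l : ℕ, Hom [k, l] [k + l]
  split : ∀ k l : ℕ, Hom [k + l] [k, l]
  par : ∀ a b : WObj, ZMod 2 → Submodule ℂ (Hom a b)
  /- ℂ-linear category axioms -/
  id_comp : ∀ {a b : WObj} (f : Hom a b), comp (id a) f = f
  comp_id : ∀ {a b : WObj} (f : Hom a b), comp f (id b) = f
  comp_assoc : ∀ {a b c d : WObj} (f : Hom a b) (g : Hom b c) (h : Hom c d),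
    comp (comp f g) h = comp f (comp g h)
  comp_add_left : ∀ {a b c : WObj} (f g : Hom a b) (h : Hom b c),
    comp (f + g) h = comp f h + comp g h
  comp_add_right : ∀ {a b c : WObj} (f : Hom a b) (g h : Hom b c),
    comp f (g + h) = comp f g + comp f h
  comp_smul_left : ∀ {a b c : WObj} (z : ℂ) (f : Hom a b) (h : Hom b c),
    comp (z • f) h = z • comp f h
  comp_smul_right : ∀ {a b c : WObj} (z : ℂ) (f : Hom a b) (h : Hom b c),
    comp f (z • h) = z • comp f h
  tensor_add_left : ∀ {a b a' b' : WObj} (f g : Hom a b) (h : Hom a' b'),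
    tensor (f + g) h = tensor f h + tensor g h
  tensor_add_right : ∀ {a b a' b' : WObj} (f : Hom a b) (g h : Hom a' b'),
    tensor f (g + h) = tensor f g + tensor f h
  tensor_smul_left : ∀ {a b a' b' : WObj} (z : ℂ) (f : Hom a b) (h : Hom a' b'),
    tensor (z • f) h = z • tensor f h
  tensor_smul_right : ∀ {a b a' b' : WObj} (z : ℂ) (f : Hom a b) (h : Hom a' b'),
    tensor f (z • h) = z • tensor f h
  tensor_id : ∀ a b : WObj, tensor (id a) (id b) = id (a ++ b)
  /- super-interchange law for homogeneous morphisms -/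
  tensor_interchange : ∀ {a b c a' b' c' : WObj} (f : Hom a b) (g : Hom b c)
      (f' : Hom a' b') (g' : Hom b' c') (p q : ZMod 2),
      f' ∈ par a' b' p → g ∈ par b c q →
      comp (tensor f f') (tensor g g')
        = ((-1 : ℂ) ^ (p * q).val) • tensor (comp f g) (comp f' g')
  rel_tensor_assoc : ∀ {a b a' b' a'' b'' : WObj} (f : Hom a b) (g : Hom a' b')
      (h : Hom a'' b''), HEq (tensor (tensor f g) h) (tensor f (tensor g h))
  /- parity (supercategory) axioms -/
  par_cover : ∀ a b : WObj, par a b 0 ⊔ par a b 1 = ⊤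
  par_indep : ∀ a b : WObj, par a b 0 ⊓ par a b 1 = ⊥
  par_id : ∀ a : WObj, id a ∈ par a a 0
  par_comp : ∀ {a b c : WObj} {p q : ZMod 2} {f : Hom a b} {g : Hom b c},
    f ∈ par a b p → g ∈ par b c q → comp f g ∈ par a c (p + q)
  par_tensor : ∀ {a b a' b' : WObj} {p q : ZMod 2} {f : Hom a b} {g : Hom a' b'},
    f ∈ par a b p → g ∈ par a' b' q → tensor f g ∈ par (a ++ a') (b ++ b') (p + q)
  par_dot : ∀ k, dot k ∈ par [k] [k] 1
  par_merge : ∀ k l, merge k l ∈ par [k, l] [k + l] 0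
  par_split : ∀ k l, split k l ∈ par [k + l] [k, l] 0
  /- defining web relations (Definition 4.1) -/
  rel_merge_assoc : ∀ h k l : ℕ,
    HEq (comp (tensor (merge h k) (id [l])) (merge (h + k) l))
        (comp (tensor (id [h]) (merge k l)) (merge h (k + l)))
  rel_split_assoc : ∀ h k l : ℕ,
    HEq (comp (split (h + k) l) (tensor (split h k) (id [l])))
        (comp (split h (k + l)) (tensor (id [h]) (split k l)))
  rel_digon : ∀ k l : ℕ,
    comp (split k l) (merge k l) = (((k + l).choose l : ℕ) : ℂ) • id [k + l]
  rel_dot_dot : ∀ k : ℕ, comp (dot k) (dot k) = (k : ℂ) • id [k]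
  rel_dots_merge : ∀ k l : ℕ,
    comp (merge k l) (dot (k + l))
      = comp (show Hom [k, l] [k, l] from tensor (dot k) (id [l])) (merge k l)
        + comp (show Hom [k, l] [k, l] from tensor (id [k]) (dot l)) (merge k l)
  rel_dots_split : ∀ k l : ℕ,
    comp (dot (k + l)) (split k l)
      = comp (split k l) (show Hom [k, l] [k, l] from tensor (dot k) (id [l]))
        + comp (split k l) (show Hom [k, l] [k, l] from tensor (id [k]) (dot l))
  rel_dumbbell :
    comp (merge 1 1) (split 1 1)
      = comp (show Hom [1, 1] [1, 1] from tensor (dot 1) (dot 1))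
          (comp (comp (merge 1 1) (split 1 1))
            (show Hom [1, 1] [1, 1] from tensor (dot 1) (dot 1)))
        + (2 : ℂ) • id [1, 1]
  rel_square_switch : ∀ k l : ℕ,
    comp
        (comp (show Hom [k + 1, 1 + l] [k, 1, 1 + l] from tensor (split k 1) (id [1 + l]))
          (show Hom [k, 1, 1 + l] [k, 1 + (1 + l)] from tensor (id [k]) (merge 1 (1 + l))))
        (comp (show Hom [k, 1 + (1 + l)] [k, 1, 1 + l] from tensor (id [k]) (split 1 (1 + l)))
          (show Hom [k, 1, 1 + l] [k + 1, 1 + l] from tensor (merge k 1) (id [1 + l])))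
      - comp
          (comp (show Hom [k + 1, 1 + l] [k + 1, 1, l] from tensor (id [k + 1]) (split 1 l))
            (show Hom [k + 1, 1, l] [k + 2, l] from tensor (merge (k + 1) 1) (id [l])))
          (comp (show Hom [k + 2, l] [k + 1, 1, l] from tensor (split (k + 1) 1) (id [l]))
            (show Hom [k + 1, 1, l] [k + 1, 1 + l] from tensor (id [k + 1]) (merge 1 l)))
      = (((k : ℂ) + 1) - ((l : ℂ) + 1)) • id [k + 1, 1 + l]

namespace QWebUp

/-- Transport of morphisms along equalities of objects. -/
def rc (W : QWebUp) {a a' b b' : WObj} (ha : a = a') (hb : b = b') (f : W.Hom a b) :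
    W.Hom a' b' := ha ▸ hb ▸ f

/-- The object `↑₁^k`. -/
def oneW (k : ℕ) : WObj := List.replicate k 1

theorem oneW_succ (k : ℕ) : oneW (k + 1) = oneW k ++ [1] := List.replicate_add k 1 1

theorem oneW_sum (k : ℕ) : (oneW k).sum = k := by
  induction k with
  | zero => rfl
  | succ k ih => simp only [oneW, List.replicate_succ, List.sum_cons] at *; omega

theorem oneW_split2 {i j k : ℕ} (h : i + 2 + j = k) :
    (oneW i ++ [1, 1]) ++ oneW j = oneW k := by
  subst h
  show (List.replicate i 1 ++ List.replicate 2 1) ++ List.replicate j 1 = _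
  rw [← List.replicate_add, ← List.replicate_add]
  rfl

theorem oneW_split1 {i j k : ℕ} (h : i + 1 + j = k) :
    (oneW i ++ [1]) ++ oneW j = oneW k := by
  subst h
  show (List.replicate i 1 ++ List.replicate 1 1) ++ List.replicate j 1 = _
  rw [← List.replicate_add, ← List.replicate_add]
  rfl

/-- The crossing of two `↑₁` strands: `split ∘ merge − id`. -/
def cross (W : QWebUp) : W.Hom [1, 1] [1, 1] :=
  W.comp (W.merge 1 1) (W.split 1 1) - W.id [1, 1]

/-- Apply a two-strand endomorphism on strands `i, i+1` of `↑₁^k`. -/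
def onPair (W : QWebUp) (k i : ℕ) (g : W.Hom [1, 1] [1, 1]) :
    W.Hom (oneW k) (oneW k) :=
  if h : i + 2 ≤ k then
    W.rc (oneW_split2 (by omega)) (oneW_split2 (by omega))
      (W.tensor (W.tensor (W.id (oneW i)) g) (W.id (oneW (k - i - 2))))
  else 0

/-- Apply a one-strand endomorphism on strand `i` of `↑₁^k`. -/
def onOne (W : QWebUp) (k i : ℕ) (g : W.Hom [1] [1]) :
    W.Hom (oneW k) (oneW k) :=
  if h : i + 1 ≤ k then
    W.rc (oneW_split1 (by omega)) (oneW_split1 (by omega))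
      (W.tensor (W.tensor (W.id (oneW i)) g) (W.id (oneW (k - i - 1))))
  else 0

/-- `s_i`: the crossing of strands `i, i+1` (0-indexed) of `↑₁^k`. -/
def sGen (W : QWebUp) (k i : ℕ) : W.Hom (oneW k) (oneW k) := W.onPair k i W.cross

/-- `c_i`: the dot on strand `i` (0-indexed) of `↑₁^k`. -/
def cGen (W : QWebUp) (k i : ℕ) : W.Hom (oneW k) (oneW k) := W.onOne k i (W.dot 1)

/-- The iterated merge `merge^{(k+1)} : ↑₁^{k+1} → ↑_{k+1}`. -/
def mergeAll (W : QWebUp) : (k : ℕ) → W.Hom (oneW (k + 1)) [k + 1]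
  | 0 => W.id [1]
  | k + 1 =>
    W.comp (W.rc (oneW_succ (k + 1)).symm rfl (W.tensor (mergeAll W k) (W.id [1])))
      (W.merge (k + 1) 1)

/-- The iterated split `split^{(k+1)} : ↑_{k+1} → ↑₁^{k+1}`. -/
def splitAll (W : QWebUp) : (k : ℕ) → W.Hom [k + 1] (oneW (k + 1))
  | 0 => W.id [1]
  | k + 1 =>
    W.comp (W.split (k + 1) 1)
      (W.rc rfl (oneW_succ (k + 1)).symm (W.tensor (splitAll W k) (W.id [1])))

/-- The clasp idempotent `Cl_{k+1} = (1/(k+1)!) split^{(k+1)} ∘ merge^{(k+1)}`. -/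
def clasp (W : QWebUp) (k : ℕ) : W.Hom (oneW (k + 1)) (oneW (k + 1)) :=
  ((Nat.factorial (k + 1) : ℕ) : ℂ)⁻¹ • W.comp (mergeAll W k) (splitAll W k)

end QWebUp

/-- A word in the simple transpositions representing the transposition `(0 i)`. -/
def swapWord : ℕ → List ℕ
  | 0 => []
  | m + 1 => (List.range (m + 1)).reverse ++ (List.range (m + 1)).drop 1

/-- A canonical word in the (0-indexed) simple transpositions representing a
permutation, via the standard recursive decomposition. -/
def permWord : {n : ℕ} → Equiv.Perm (Fin n) → List ℕ
  | 0, _ => []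
  | _ + 1, σ =>
    swapWord ((Equiv.Perm.decomposeFin σ).1 : ℕ)
      ++ (permWord (Equiv.Perm.decomposeFin σ).2).map (· + 1)

namespace QWebUp

/-- Compose a list of endomorphisms (in the order of the list, as an ordinary
product of operators: the head of the list is applied last). -/
def compSeq (W : QWebUp) {a : WObj} (l : List (W.Hom a a)) : W.Hom a a :=
  l.foldr (fun f g => W.comp g f) (W.id a)

/-- The endomorphism of `↑₁^k` given by a word in the crossings. -/
def ofWordW (W : QWebUp) (k : ℕ) (w : List ℕ) : W.Hom (oneW k) (oneW k) :=
  compSeq W (w.map fun j => sGen W k j)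

/-- `ξ_k(σ)`: the permutation web attached to `σ ∈ Σ_k`. -/
def permW (W : QWebUp) (k : ℕ) (σ : Equiv.Perm (Fin k)) : W.Hom (oneW k) (oneW k) :=
  ofWordW W k (permWord σ)

end QWebUp

open CategoryTheory in
/-- The opposite of a linear category is linear. -/
abbrev linearOpposite (R : Type*) [CommRing R] (C : Type*) [Category C] [Preadditive C]
    [Linear R C] : Linear R Cᵒᵖ where
  homModule X Y :=
    { smul := fun r f => (r • f.unop).op
      one_smul := fun f => Quiver.Hom.unop_inj (one_smul R f.unop)
      mul_smul := fun r s f => Quiver.Hom.unop_inj (mul_smul r s f.unop)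
      smul_zero := fun r => Quiver.Hom.unop_inj (smul_zero (A := Y.unop ⟶ X.unop) r)
      smul_add := fun r f g => Quiver.Hom.unop_inj (smul_add r f.unop g.unop)
      add_smul := fun r s f => Quiver.Hom.unop_inj (add_smul r s f.unop)
      zero_smul := fun f => Quiver.Hom.unop_inj (zero_smul R f.unop) }
  smul_comp _ _ _ r f g := Quiver.Hom.unop_inj (Linear.comp_smul _ _ _ g.unop r f.unop)
  comp_smul _ _ _ f r g := Quiver.Hom.unop_inj (Linear.smul_comp _ _ _ r g.unop f.unop)

open CategoryTheory in
/-- If `F` intertwines `S'` and `S` on symmetric vectors and intertwines the anticommuting elements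
`k'` and `k` up to `d`, then `d ≫ F` intertwines `S'` and `S`. -/
theorem intertwine_of_symmetric {C : Type*} [Category C] [Preadditive C] [Linear ℂ C] {X Y : C}
    {S k : X ⟶ X} {S' k' d : Y ⟶ Y} {F : Y ⟶ X}
    (hSk : S ≫ k = -(k ≫ S)) (hSk' : S' ≫ k' = -(k' ≫ S'))
    (hk' : k' ≫ k' = (2 : ℂ) • 𝟙 Y) (hd : d ≫ d = 0) (hdk : d ≫ k' = -(k' ≫ d))
    (hdS : S' ≫ d = d ≫ S') (hFk : F ≫ k = k' ≫ F - d ≫ F)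
    (hF : S' ≫ F + S' ≫ F ≫ S = F + F ≫ S) :
    S' ≫ d ≫ F = d ≫ F ≫ S ∧
      ∀ P : Y ⟶ Y, P ≫ S' = P → P ≫ F - P ≫ F ≫ S = P ≫ k' ≫ d ≫ F := by
  have h2 := congr(k' ≫ $hF ≫ k)
  simp only [Preadditive.add_comp, Preadditive.comp_add, Category.assoc, hFk, hSk,
    Preadditive.comp_neg, Preadditive.comp_sub, reassoc_of% hFk, reassoc_of% hSk',
    reassoc_of% hk', Preadditive.sub_comp, Preadditive.neg_comp, Linear.smul_comp,
    Category.id_comp] at h2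
  have h3 := congr(d ≫ $h2)
  have h4 := congr(d ≫ $hF)
  simp only [Preadditive.comp_add, Category.assoc, Preadditive.comp_neg, Preadditive.comp_sub,
    reassoc_of% hdk, reassoc_of% hdS, reassoc_of% hd, Preadditive.neg_comp, Linear.comp_smul,
    Limits.zero_comp, Limits.comp_zero] at h3 h4
  have h5 : S' ≫ d ≫ F = d ≫ F ≫ S := by
    rw [reassoc_of% hdS]
    linear_combination (norm := module) (-1/4 : ℂ) • h3 + (1/2 : ℂ) • h4
  refine ⟨h5, fun P hP => ?_⟩
  have hPk : P ≫ k' ≫ S' = -(P ≫ k') := by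
    have := congr(P ≫ $hSk')
    rw [reassoc_of% hP, Preadditive.comp_neg] at this
    rw [this, neg_neg]
  have h6 := congr(P ≫ $h2)
  have h5' : S' ≫ d ≫ F ≫ S = d ≫ F ≫ S ≫ S := by simpa using congr($h5 ≫ S)
  simp only [Preadditive.comp_add, Preadditive.comp_neg, Preadditive.comp_sub, Linear.comp_smul,
    reassoc_of% hP, reassoc_of% hPk, Preadditive.neg_comp, Category.assoc] at h6
  have h7 : P ≫ k' ≫ d ≫ F ≫ S = -(P ≫ k' ≫ d ≫ F) := by
    rw [← h5, reassoc_of% hPk]; simp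
  rw [h7] at h6
  linear_combination (norm := module) (-1/4 : ℂ) • h6

open CategoryTheory in
/-- For involutions `S₁`, `S₂` and `A = ab a - a` with `a = 1 + S₁`, `b = 1 + S₂`, a factorization
`A = u ≫ P ≫ F` through an `S'`-invariant `P` forces `A` to be invariant under `S₂`. -/
theorem invariant_of_factorization {C : Type*} [Category C] [Preadditive C] [Linear ℂ C] {X Y : C}
    {S₁ S₂ k l A : X ⟶ X} {S₁' S₂' k' d P : Y ⟶ Y} {u : X ⟶ Y} {F : Y ⟶ X}
    (h₁ : S₁ ≫ S₁ = 𝟙 X) (h₂ : S₂ ≫ S₂ = 𝟙 X)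
    (hSk : S₂ ≫ k = -(k ≫ S₂)) (hkl : k ≫ S₁ = S₁ ≫ l) (hlk : l ≫ S₂ = S₂ ≫ (l - k))
    (hSk' : S₂' ≫ k' = -(k' ≫ S₂'))
    (hk' : k' ≫ k' = (2 : ℂ) • 𝟙 Y) (hd : d ≫ d = 0) (hdk : d ≫ k' = -(k' ≫ d))
    (hdS₁ : S₁' ≫ d = d ≫ S₁') (hdS₂ : S₂' ≫ d = d ≫ S₂')
    (hFk : F ≫ k = k' ≫ F - d ≫ F) (hF₁ : S₁' ≫ F = F ≫ S₁)
    (hF₂ : S₂' ≫ F + S₂' ≫ F ≫ S₂ = F + F ≫ S₂)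
    (huk : k ≫ u = u ≫ k' - u ≫ d) (hu₁ : S₁ ≫ u = u ≫ S₁')
    (hu₂ : u ≫ S₂' + S₂ ≫ u ≫ S₂' = u + S₂ ≫ u)
    (hP₁ : S₁' ≫ P = P) (hP₁' : P ≫ S₁' = P) (hP₂ : S₂' ≫ P = P) (hP₂' : P ≫ S₂' = P)
    (hPd : P ≫ d = d ≫ P)
    (hA : A = (𝟙 X + S₁) ≫ (𝟙 X + S₂) ≫ (𝟙 X + S₁) - (𝟙 X + S₁))
    (hAP : A = u ≫ P ≫ F) : A ≫ S₂ = A := by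
  obtain ⟨hdF, hPF⟩ := intertwine_of_symmetric hSk hSk' hk' hd hdk hdS₂ hFk hF₂
  have hud : S₂ ≫ u ≫ d = u ≫ d ≫ S₂' := by
    let _ := linearOpposite ℂ C
    have := (intertwine_of_symmetric (C := Cᵒᵖ) (S := S₂.op) (k := k.op) (S' := S₂'.op)
      (k' := k'.op) (d := d.op) (F := u.op)
      (by rw [← op_comp, ← op_comp, hSk, op_neg, neg_neg])
      (by rw [← op_comp, ← op_comp, hSk', op_neg, neg_neg])
      (by rw [← op_comp, hk']; rfl) (by rw [← op_comp, hd]; rfl)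
      (by rw [← op_comp, ← op_comp, hdk, op_neg, neg_neg])
      (by rw [← op_comp, ← op_comp, hdS₂])
      (by rw [← op_comp, huk]; rfl)
      (by simpa using congr(($hu₂).op))).1
    simpa using congr(($this).unop).symm
  have hQ : A ≫ S₂ - A = u ≫ P ≫ d ≫ F ≫ k := by
    have h := congr(u ≫ $(hPF P hP₂'))
    have hdk' : k' ≫ d = -(d ≫ k') := by rw [hdk, neg_neg]
    have h' : P ≫ k' ≫ d ≫ F = -(P ≫ d ≫ F ≫ k) := by
      rw [hFk, reassoc_of% hdk', Preadditive.comp_sub, reassoc_of% hd]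
      simp
    rw [h'] at h
    simp only [Preadditive.comp_sub, Preadditive.comp_neg] at h
    rw [hAP]
    simp only [Category.assoc]
    linear_combination (norm := module) (-1 : ℂ) • h
  have hZ₁ : u ≫ P ≫ d ≫ F ≫ S₁ = u ≫ P ≫ d ≫ F := by
    rw [← hF₁, ← reassoc_of% hdS₁, reassoc_of% hP₁']
  have hZ₂ : u ≫ P ≫ d ≫ F ≫ S₂ = u ≫ P ≫ d ≫ F := by
    rw [← hdF, reassoc_of% hP₂']
  have hZ₁' : S₁ ≫ u ≫ P ≫ d ≫ F = u ≫ P ≫ d ≫ F := by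
    rw [reassoc_of% hu₁, reassoc_of% hP₁]
  have hZ₂' : S₂ ≫ u ≫ P ≫ d ≫ F = u ≫ P ≫ d ≫ F := by
    rw [reassoc_of% hPd, reassoc_of% hud, reassoc_of% hP₂]
  have hR : (A ≫ S₂ - A) ≫ (S₁ ≫ S₂ + S₂ ≫ S₁) = -(A ≫ S₂ - A) := by
    have hks : k ≫ S₂ = -(S₂ ≫ k) := by rw [hSk, neg_neg]
    have hkω : k ≫ (S₁ ≫ S₂ + S₂ ≫ S₁) = S₁ ≫ S₂ ≫ (l - k) - S₂ ≫ S₁ ≫ l := by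
      rw [Preadditive.comp_add, reassoc_of% hkl, hlk, reassoc_of% hks]
      simp [hkl, sub_eq_add_neg]
    rw [hQ]
    have e₁ : (u ≫ P ≫ d ≫ F) ≫ S₁ = u ≫ P ≫ d ≫ F := by simpa using hZ₁
    have e₂ : (u ≫ P ≫ d ≫ F) ≫ S₂ = u ≫ P ≫ d ≫ F := by simpa using hZ₂
    have e₃ : u ≫ P ≫ d ≫ F ≫ k = (u ≫ P ≫ d ≫ F) ≫ k := by simp
    rw [e₃, Category.assoc, hkω]
    generalize u ≫ P ≫ d ≫ F = Z at e₁ e₂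
    simp only [Preadditive.comp_sub, reassoc_of% e₁, reassoc_of% e₂]
    module
  have hL : (S₁ ≫ S₂ + S₂ ≫ S₁) ≫ (A ≫ S₂ - A) = (2 : ℂ) • (A ≫ S₂ - A) := by
    rw [hQ]
    have e₁ := congr($hZ₁' ≫ k)
    have e₂ := congr($hZ₂' ≫ k)
    simp only [Category.assoc] at e₁ e₂
    simp only [Preadditive.add_comp, Category.assoc, e₁, e₂]
    module
  have hC : (S₁ ≫ S₂ + S₂ ≫ S₁) ≫ (A ≫ S₂ - A) = (A ≫ S₂ - A) ≫ (S₁ ≫ S₂ + S₂ ≫ S₁) := by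
    rw [hA]
    simp only [Preadditive.add_comp, Preadditive.comp_add, Preadditive.sub_comp,
      Preadditive.comp_sub, Category.assoc, Category.id_comp, Category.comp_id, h₁, h₂,
      reassoc_of% h₁, reassoc_of% h₂]
    module
  rw [hR, hL] at hC
  have : A ≫ S₂ - A = 0 := by
    linear_combination (norm := module) (1/3 : ℂ) • hC
  exact sub_eq_zero.mp this

open CategoryTheory in
/-- The braid relation for involutions `S₁`, `S₂` from the one-sided invariance of `aba - a`, where
`a = 1 + S₁` and `b = 1 + S₂`, and an invertible `δ` anticommuting with `S₁` and `S₂`. -/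
theorem braid_of_invariant {C : Type*} [Category C] [Preadditive C] [Linear ℂ C] {X : C}
    {S₁ S₂ δ ε : X ⟶ X} (h₁ : S₁ ≫ S₁ = 𝟙 X) (h₂ : S₂ ≫ S₂ = 𝟙 X)
    (hδ₁ : δ ≫ S₁ = -(S₁ ≫ δ)) (hδ₂ : δ ≫ S₂ = -(S₂ ≫ δ)) (hδ : δ ≫ ε = 𝟙 X)
    (hA : ((𝟙 X + S₁) ≫ (𝟙 X + S₂) ≫ (𝟙 X + S₁) - (𝟙 X + S₁)) ≫ S₂
      = (𝟙 X + S₁) ≫ (𝟙 X + S₂) ≫ (𝟙 X + S₁) - (𝟙 X + S₁)) :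
    S₁ ≫ S₂ ≫ S₁ = S₂ ≫ S₁ ≫ S₂ := by
  simp only [Preadditive.add_comp, Preadditive.comp_add, Preadditive.sub_comp,
    Category.assoc, Category.id_comp, Category.comp_id, h₁, h₂] at hA
  have hB : S₂ ≫ S₁ + S₁ ≫ S₂ ≫ S₁ = S₂ ≫ S₁ ≫ S₂ + S₁ ≫ S₂ ≫ S₁ ≫ S₂ := by
    linear_combination (norm := module) -hA
  have hB' := congr(δ ≫ $hB ≫ ε)
  simp only [Preadditive.add_comp, Preadditive.comp_add, Category.assoc, reassoc_of% hδ₁,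
    reassoc_of% hδ₂, hδ, Preadditive.neg_comp, Preadditive.comp_neg, Category.comp_id] at hB'
  have hC : S₂ ≫ S₁ = S₁ ≫ S₂ ≫ S₁ ≫ S₂ := by
    linear_combination (norm := module) (1/2 : ℂ) • hB + (1/2 : ℂ) • hB'
  rw [hC, reassoc_of% h₁]

open CategoryTheory in
/-- If `S` is the crossing and `x`, `y` the dots on its strands, the dumbbell relation and the
commutation of `S` with `x + y` make the dots slide through the crossing. -/
theorem slide_of_dumbbell {C : Type*} [Category C] [Preadditive C] [Linear ℂ C] {Z : C}
    {x y S : Z ⟶ Z} (hx : x ≫ x = 𝟙 Z) (hy : y ≫ y = 𝟙 Z) (hyx : y ≫ x = -(x ≫ y))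
    (hS : S + 𝟙 Z = (x ≫ y) ≫ (S + 𝟙 Z) ≫ x ≫ y + (2 : ℂ) • 𝟙 Z)
    (hxy : S ≫ x + S ≫ y = x ≫ S + y ≫ S) : x ≫ S = S ≫ y := by
  have h₀ := congr(x ≫ y ≫ $hS)
  have h₁ := congr($hxy ≫ x ≫ y)
  simp only [Preadditive.add_comp, Preadditive.comp_add, Category.assoc, reassoc_of% hx,
    Linear.comp_smul, Category.comp_id, Category.id_comp, reassoc_of% hyx, hy, Preadditive.comp_neg,
    Preadditive.neg_comp] at h₀ h₁
  have h₂ : S ≫ x ≫ y = -(x ≫ y ≫ S) := by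
    simp only [reassoc_of% hy, hyx] at h₀
    linear_combination (norm := module) h₀
  simp only [h₂, Preadditive.comp_neg, reassoc_of% hx, reassoc_of% hyx, reassoc_of% hy,
    Preadditive.neg_comp, Category.assoc] at h₁
  linear_combination (norm := module) (-1/2 : ℂ) • h₁ - (1/2 : ℂ) • hxy

namespace QWebUp

open CategoryTheory

section Transport

variable (W : QWebUp)

theorem rc_heq {a a' b b' : WObj} (ha : a = a') (hb : b = b') (f : W.Hom a b) :
    HEq (W.rc ha hb f) f := by
  subst ha hb; rfl

theorem tensor_heq {a a' b b' c c' d d' : WObj} (ha : a = a') (hb : b = b') (hc : c = c')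
    (hd : d = d') {f : W.Hom a b} {f' : W.Hom a' b'} {g : W.Hom c d} {g' : W.Hom c' d'}
    (hf : HEq f f') (hg : HEq g g') : HEq (W.tensor f g) (W.tensor f' g') := by
  subst ha hb hc hd hf hg; rfl

end Transport

/-- The objects of the category underlying `W`. -/
structure Word (W : QWebUp) where
  /-- The underlying word. -/
  word : WObj

variable {W : QWebUp}

instance : Category (Word W) where
  Hom a b := W.Hom a.word b.word
  id a := W.id a.word
  comp f g := W.comp f g
  id_comp := W.id_comp
  comp_id := W.comp_id
  assoc := W.comp_assoc

instance : Preadditive (Word W) where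
  homGroup a b := inferInstanceAs (AddCommGroup (W.Hom a.word b.word))
  add_comp _ _ _ := W.comp_add_left
  comp_add _ _ _ := W.comp_add_right

instance : Linear ℂ (Word W) where
  homModule a b := inferInstanceAs (Module ℂ (W.Hom a.word b.word))
  smul_comp _ _ _ := W.comp_smul_left
  comp_smul _ _ _ f z g := W.comp_smul_right z f g

/-- The morphism `f` with identity strands `a` on its left and `b` on its right. -/
def whisker (a b : WObj) {x y s t : WObj} (f : W.Hom x y) (hs : a ++ x ++ b = s := by simp)
    (ht : a ++ y ++ b = t := by simp) : (⟨s⟩ : Word W) ⟶ ⟨t⟩ :=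
  W.rc hs ht (W.tensor (W.tensor (W.id a) f) (W.id b))

theorem whisker_heq (a b : WObj) {x y s t : WObj} (f : W.Hom x y) (hs : a ++ x ++ b = s)
    (ht : a ++ y ++ b = t) :
    HEq (whisker a b f hs ht) (W.tensor (W.tensor (W.id a) f) (W.id b)) :=
  W.rc_heq hs ht _

theorem whisker_id (a b : WObj) {x s : WObj} (hs : a ++ x ++ b = s) :
    whisker a b (W.id x) hs hs = 𝟙 (⟨s⟩ : Word W) := by
  subst hs
  change W.tensor (W.tensor (W.id a) (W.id x)) (W.id b) = W.id _
  rw [W.tensor_id, W.tensor_id]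

theorem whisker_add (a b : WObj) {x y s t : WObj} (f g : W.Hom x y) (hs : a ++ x ++ b = s)
    (ht : a ++ y ++ b = t) :
    whisker a b (f + g) hs ht = whisker a b f hs ht + whisker a b g hs ht := by
  subst hs ht
  change W.tensor (W.tensor (W.id a) (f + g)) (W.id b) = _
  rw [W.tensor_add_right, W.tensor_add_left]; rfl

theorem whisker_smul (a b : WObj) {x y s t : WObj} (z : ℂ) (f : W.Hom x y)
    (hs : a ++ x ++ b = s) (ht : a ++ y ++ b = t) :
    whisker a b (z • f) hs ht = z • whisker a b f hs ht := by
  subst hs ht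
  change W.tensor (W.tensor (W.id a) (z • f)) (W.id b) = _
  rw [W.tensor_smul_right, W.tensor_smul_left]; rfl

theorem whisker_sub (a b : WObj) {x y s t : WObj} (f g : W.Hom x y) (hs : a ++ x ++ b = s)
    (ht : a ++ y ++ b = t) :
    whisker a b (f - g) hs ht = whisker a b f hs ht - whisker a b g hs ht := by
  rw [sub_eq_add_neg, ← neg_one_smul ℂ g, whisker_add, whisker_smul, neg_one_smul, sub_eq_add_neg]

theorem id_tensor_comp (a : WObj) {x y z : WObj} (f : W.Hom x y) (g : W.Hom y z) :
    W.comp (W.tensor (W.id a) f) (W.tensor (W.id a) g) = W.tensor (W.id a) (W.comp f g) := by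
  have hf : f ∈ W.par x y 0 ⊔ W.par x y 1 := by rw [W.par_cover]; trivial
  obtain ⟨f₀, h₀, f₁, h₁, rfl⟩ := Submodule.mem_sup.mp hf
  rw [W.tensor_add_right, W.comp_add_left, W.comp_add_left, W.tensor_add_right,
    W.tensor_interchange _ _ _ _ 0 0 h₀ (W.par_id a), W.tensor_interchange _ _ _ _ 1 0 h₁ (W.par_id a)]
  simp [W.id_comp]

theorem tensor_id_comp (b : WObj) {x y z : WObj} (f : W.Hom x y) (g : W.Hom y z) :
    W.comp (W.tensor f (W.id b)) (W.tensor g (W.id b)) = W.tensor (W.comp f g) (W.id b) := by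
  have hg : g ∈ W.par y z 0 ⊔ W.par y z 1 := by rw [W.par_cover]; trivial
  obtain ⟨g₀, h₀, g₁, h₁, rfl⟩ := Submodule.mem_sup.mp hg
  rw [W.tensor_add_left, W.comp_add_right, W.comp_add_right, W.tensor_add_left,
    W.tensor_interchange _ _ _ _ 0 0 (W.par_id b) h₀, W.tensor_interchange _ _ _ _ 0 1 (W.par_id b) h₁]
  simp [W.id_comp]

theorem whisker_comp (a b : WObj) {x y z s t r : WObj} (f : W.Hom x y) (g : W.Hom y z)
    (hs : a ++ x ++ b = s) (ht : a ++ y ++ b = t) (hr : a ++ z ++ b = r) :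
    whisker a b (W.comp f g) hs hr = whisker a b f hs ht ≫ whisker a b g ht hr := by
  subst hs ht hr
  change W.tensor (W.tensor (W.id a) (W.comp f g)) (W.id b) = W.comp (W.tensor _ _) (W.tensor _ _)
  rw [tensor_id_comp, id_tensor_comp]

theorem whisker_tensor_id (a b c : WObj) {x y s t : WObj} (f : W.Hom x y)
    (hs : a ++ (x ++ c) ++ b = s) (ht : a ++ (y ++ c) ++ b = t) :
    whisker a b (W.tensor f (W.id c)) hs ht
      = whisker a (c ++ b) f (by simp [← hs]) (by simp [← ht]) := by
  refine eq_of_heq ((whisker_heq ..).trans (HEq.trans ?_ (whisker_heq ..).symm))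
  refine (W.tensor_heq (by simp) (by simp) rfl rfl (W.rel_tensor_assoc _ _ _).symm HEq.rfl).trans ?_
  refine (W.rel_tensor_assoc _ _ _).trans ?_
  rw [W.tensor_id]

theorem whisker_id_tensor (a b c : WObj) {x y s t : WObj} (f : W.Hom x y)
    (hs : a ++ (c ++ x) ++ b = s) (ht : a ++ (c ++ y) ++ b = t) :
    whisker a b (W.tensor (W.id c) f) hs ht
      = whisker (a ++ c) b f (by simp [← hs]) (by simp [← ht]) := by
  refine eq_of_heq ((whisker_heq ..).trans (HEq.trans ?_ (whisker_heq ..).symm))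
  refine (W.tensor_heq (by simp) (by simp) rfl rfl (W.rel_tensor_assoc _ _ _).symm HEq.rfl).trans ?_
  rw [W.tensor_id]

/-- Super-interchange for morphisms on disjoint sets of strands. -/
theorem whisker_interchange {a c x y z w s t t' r bz bw ax ay : WObj} (b : WObj) {f : W.Hom x y}
    {g : W.Hom z w} {i j : ZMod 2} (hf : f ∈ W.par x y i) (hg : g ∈ W.par z w j)
    (hs : a ++ x ++ bz = s) (ht : a ++ y ++ bz = t) (ht₂ : ay ++ z ++ c = t)
    (hr : ay ++ w ++ c = r) (hs₂ : ax ++ z ++ c = s) (ht' : ax ++ w ++ c = t')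
    (ht'₂ : a ++ x ++ bw = t') (hr₂ : a ++ y ++ bw = r)
    (hbz : b ++ z ++ c = bz := by simp) (hbw : b ++ w ++ c = bw := by simp)
    (hax : a ++ x ++ b = ax := by simp) (hay : a ++ y ++ b = ay := by simp) :
    whisker ax c g hs₂ ht' ≫ whisker a bw f ht'₂ hr₂
      = ((-1 : ℂ) ^ (j * i).val) • (whisker a bz f hs ht ≫ whisker ay c g ht₂ hr) := by
  subst hbz hbw hax hay hs ht ht'₂ hr₂
  have key : ∀ (v : WObj) (h₁ : v ++ b ++ z ++ c = v ++ (b ++ z ++ c))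
      (h₂ : v ++ b ++ w ++ c = v ++ (b ++ w ++ c)),
      whisker (v ++ b) c g h₁ h₂
        = W.tensor (W.id v) (W.tensor (W.tensor (W.id b) g) (W.id c)) := fun v h₁ h₂ => by
    refine eq_of_heq ((whisker_heq ..).trans ?_)
    rw [← W.tensor_id]
    exact (W.tensor_heq (by simp) (by simp) rfl rfl (W.rel_tensor_assoc _ _ _) HEq.rfl).trans
      (W.rel_tensor_assoc _ _ _)
  rw [key, key]
  have hG : W.tensor (W.tensor (W.id b) g) (W.id c) ∈ W.par _ _ j := by
    simpa using W.par_tensor (W.par_tensor (W.par_id b) hg) (W.par_id c)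
  have hL : W.tensor (W.id a) f ∈ W.par _ _ i := by
    simpa using W.par_tensor (W.par_id a) hf
  change W.comp (W.tensor _ _) (W.tensor (W.tensor (W.id a) f) (W.id (b ++ w ++ c)))
    = _ • W.comp (W.tensor (W.tensor (W.id a) f) (W.id (b ++ z ++ c))) (W.tensor _ _)
  rw [W.tensor_interchange _ _ _ _ j i hG hL,
    W.tensor_interchange _ _ _ _ 0 0 (W.par_id _) (W.par_id _)]
  simp [W.id_comp, W.comp_id]

section Generators

variable (p q : WObj)

/-- Morphisms on disjoint sets of strands commute if one of them is even. -/
theorem whisker_interchange_of_mul_eq_zero {a c x y z w s t t' r bz bw ax ay : WObj} (b : WObj)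
    {f : W.Hom x y} {g : W.Hom z w} {i j : ZMod 2} (hf : f ∈ W.par x y i) (hg : g ∈ W.par z w j)
    (hij : j * i = 0)
    (hs : a ++ x ++ bz = s) (ht : a ++ y ++ bz = t) (ht₂ : ay ++ z ++ c = t)
    (hr : ay ++ w ++ c = r) (hs₂ : ax ++ z ++ c = s) (ht' : ax ++ w ++ c = t')
    (ht'₂ : a ++ x ++ bw = t') (hr₂ : a ++ y ++ bw = r)
    (hbz : b ++ z ++ c = bz := by simp) (hbw : b ++ w ++ c = bw := by simp)
    (hax : a ++ x ++ b = ax := by simp) (hay : a ++ y ++ b = ay := by simp) :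
    whisker ax c g hs₂ ht' ≫ whisker a bw f ht'₂ hr₂
      = whisker a bz f hs ht ≫ whisker ay c g ht₂ hr := by
  rw [whisker_interchange b hf hg hs ht ht₂ hr hs₂ ht' ht'₂ hr₂ hbz hbw hax hay, hij]
  simp

theorem cross_mem_par : W.cross ∈ W.par [1, 1] [1, 1] 0 :=
  sub_mem (W.par_comp (W.par_merge 1 1) (W.par_split 1 1)) (W.par_id _)

theorem whisker_split_merge {k l : ℕ} {s t : WObj} (hs : p ++ [k + l] ++ q = s)
    (ht : p ++ [k, l] ++ q = t) :
    (whisker p q (W.split k l) hs ht ≫ whisker p q (W.merge k l) ht hs : (⟨s⟩ : Word W) ⟶ ⟨s⟩)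
      = (((k + l).choose l : ℕ) : ℂ) • 𝟙 _ := by
  rw [← whisker_comp, W.rel_digon, whisker_smul, whisker_id]

theorem whisker_cross {s t : WObj} (hs : p ++ [1, 1] ++ q = s) (ht : p ++ [2] ++ q = t) :
    (whisker p q W.cross hs hs : (⟨s⟩ : Word W) ⟶ ⟨s⟩)
      = whisker p q (W.merge 1 1) hs ht ≫ whisker p q (W.split 1 1) ht hs - 𝟙 _ := by
  rw [cross, whisker_sub, whisker_id, whisker_comp p q _ _ hs ht hs]

theorem cross_merge {s t : WObj} (hs : p ++ [1, 1] ++ q = s) (ht : p ++ [2] ++ q = t) :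
    (whisker p q W.cross hs hs ≫ whisker p q (W.merge 1 1) hs ht : (⟨s⟩ : Word W) ⟶ ⟨t⟩)
      = whisker p q (W.merge 1 1) hs ht := by
  rw [whisker_cross p q hs ht, Preadditive.sub_comp, Category.assoc, whisker_split_merge]
  simp only [Linear.comp_smul, Category.comp_id, Category.id_comp]
  norm_num [Nat.choose]
  module

theorem split_cross {s t : WObj} (hs : p ++ [1, 1] ++ q = s) (ht : p ++ [2] ++ q = t) :
    (whisker p q (W.split 1 1) ht hs ≫ whisker p q W.cross hs hs : (⟨t⟩ : Word W) ⟶ ⟨s⟩)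
      = whisker p q (W.split 1 1) ht hs := by
  have h := whisker_split_merge (W := W) p q (k := 1) (l := 1) ht hs
  rw [whisker_cross p q hs ht, Preadditive.comp_sub, reassoc_of% h]
  simp only [Linear.smul_comp, Category.comp_id, Category.id_comp]
  norm_num [Nat.choose]
  module

theorem cross_cross {s : WObj} (hs : p ++ [1, 1] ++ q = s) :
    (whisker p q W.cross hs hs ≫ whisker p q W.cross hs hs : (⟨s⟩ : Word W) ⟶ ⟨s⟩) = 𝟙 _ := by
  have h := cross_merge (W := W) p q hs rfl
  conv_lhs => rw [whisker_cross p q hs rfl, ← whisker_cross p q hs rfl]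
  nth_rw 2 [whisker_cross p q hs rfl]
  rw [Preadditive.comp_sub, reassoc_of% h, whisker_cross p q hs rfl]
  simp

theorem dot_dot {s : WObj} (hs : p ++ [1] ++ q = s) :
    (whisker p q (W.dot 1) hs hs ≫ whisker p q (W.dot 1) hs hs : (⟨s⟩ : Word W) ⟶ ⟨s⟩) = 𝟙 _ := by
  rw [← whisker_comp, W.rel_dot_dot, whisker_smul, whisker_id]
  simp

theorem dot_zero_dot_zero {s : WObj} (hs : p ++ [0] ++ q = s) :
    (whisker p q (W.dot 0) hs hs ≫ whisker p q (W.dot 0) hs hs : (⟨s⟩ : Word W) ⟶ ⟨s⟩) = 0 := by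
  rw [← whisker_comp, W.rel_dot_dot, whisker_smul]
  simp

/-- Dots on distinct strands anticommute. -/
theorem dot_anticomm {k l : ℕ} (r : WObj) {s t u : WObj} (hs : p ++ [k] ++ t = s)
    (hu : u ++ [l] ++ q = s) (ht : r ++ [l] ++ q = t := by simp)
    (hu' : p ++ [k] ++ r = u := by simp) :
    (whisker u q (W.dot l) hu hu ≫ whisker p t (W.dot k) hs hs : (⟨s⟩ : Word W) ⟶ ⟨s⟩)
      = -(whisker p t (W.dot k) hs hs ≫ whisker u q (W.dot l) hu hu) := by
  rw [whisker_interchange r (W.par_dot k) (W.par_dot l) hs hs hu hu hu hu hs hs ht ht hu' hu']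
  simp [ZMod.val_one]

theorem whisker_dot_tensor_dot {s : WObj} (hs : p ++ [1, 1] ++ q = s) :
    (whisker p q (x := [1, 1]) (y := [1, 1]) (W.tensor (W.dot 1) (W.dot 1)) hs hs :
        (⟨s⟩ : Word W) ⟶ ⟨s⟩)
      = whisker p (1 :: q) (W.dot 1) (by simpa using hs) (by simpa using hs)
        ≫ whisker (p ++ [1]) q (W.dot 1) (by simpa using hs) (by simpa using hs) := by
  have e₁ : whisker (W := W) p q (x := [1, 1]) (y := [1, 1]) (W.tensor (W.dot 1) (W.id [1])) hs hs
      = whisker p (1 :: q) (W.dot 1) (by simpa using hs) (by simpa using hs) :=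
    whisker_tensor_id ..
  have e₂ : whisker (W := W) p q (x := [1, 1]) (y := [1, 1]) (W.tensor (W.id [1]) (W.dot 1)) hs hs
      = whisker (p ++ [1]) q (W.dot 1) (by simpa using hs) (by simpa using hs) :=
    whisker_id_tensor ..
  have h := W.tensor_interchange (W.dot 1) (W.id [1]) (W.id [1]) (W.dot 1) 0 0
    (W.par_id _) (W.par_id _)
  rw [← e₁, ← e₂, ← whisker_comp]
  congr 1
  refine Eq.trans ?_ h.symm
  simp [W.id_comp, W.comp_id]

theorem merge_dot (k l : ℕ) {s t : WObj} (hs : p ++ [k, l] ++ q = s) (ht : p ++ [k + l] ++ q = t) :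
    (whisker p q (W.merge k l) hs ht ≫ whisker p q (W.dot (k + l)) ht ht : (⟨s⟩ : Word W) ⟶ ⟨t⟩)
      = whisker p (l :: q) (W.dot k) (by simpa using hs) (by simpa using hs)
          ≫ whisker p q (W.merge k l) hs ht
        + whisker (p ++ [k]) q (W.dot l) (by simpa using hs) (by simpa using hs)
          ≫ whisker p q (W.merge k l) hs ht := by
  have e₁ : whisker (W := W) p q (x := [k, l]) (y := [k, l]) (W.tensor (W.dot k) (W.id [l])) hs hs
      = whisker p (l :: q) (W.dot k) (by simpa using hs) (by simpa using hs) :=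
    whisker_tensor_id ..
  have e₂ : whisker (W := W) p q (x := [k, l]) (y := [k, l]) (W.tensor (W.id [k]) (W.dot l)) hs hs
      = whisker (p ++ [k]) q (W.dot l) (by simpa using hs) (by simpa using hs) :=
    whisker_id_tensor ..
  rw [← whisker_comp, W.rel_dots_merge, whisker_add, ← e₁, ← e₂, ← whisker_comp, ← whisker_comp]

theorem dot_split (k l : ℕ) {s t : WObj} (hs : p ++ [k, l] ++ q = s) (ht : p ++ [k + l] ++ q = t) :
    (whisker p q (W.dot (k + l)) ht ht ≫ whisker p q (W.split k l) ht hs : (⟨t⟩ : Word W) ⟶ ⟨s⟩)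
      = whisker p q (W.split k l) ht hs
          ≫ whisker p (l :: q) (W.dot k) (by simpa using hs) (by simpa using hs)
        + whisker p q (W.split k l) ht hs
          ≫ whisker (p ++ [k]) q (W.dot l) (by simpa using hs) (by simpa using hs) := by
  have e₁ : whisker (W := W) p q (x := [k, l]) (y := [k, l]) (W.tensor (W.dot k) (W.id [l])) hs hs
      = whisker p (l :: q) (W.dot k) (by simpa using hs) (by simpa using hs) :=
    whisker_tensor_id ..
  have e₂ : whisker (W := W) p q (x := [k, l]) (y := [k, l]) (W.tensor (W.id [k]) (W.dot l)) hs hs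
      = whisker (p ++ [k]) q (W.dot l) (by simpa using hs) (by simpa using hs) :=
    whisker_id_tensor ..
  rw [← whisker_comp, W.rel_dots_split, whisker_add, ← e₁, ← e₂, ← whisker_comp, ← whisker_comp]

/-- Dots slide through crossings. -/
theorem dot_cross {s : WObj} (hs : p ++ [1, 1] ++ q = s) :
    (whisker p (1 :: q) (W.dot 1) (by simpa using hs) (by simpa using hs)
        ≫ whisker p q W.cross hs hs : (⟨s⟩ : Word W) ⟶ ⟨s⟩)
      = whisker p q W.cross hs hs
        ≫ whisker (p ++ [1]) q (W.dot 1) (by simpa using hs) (by simpa using hs) := by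
  have hX := whisker_cross (W := W) p q hs rfl
  refine slide_of_dumbbell (dot_dot ..) (dot_dot ..) (dot_anticomm p q [] ..) ?_ ?_
  · rw [← whisker_dot_tensor_dot p q hs, hX, sub_add_cancel, ← whisker_comp]
    nth_rw 1 [W.rel_dumbbell]
    rw [whisker_add, whisker_smul, whisker_id, whisker_comp p q _ _ hs hs hs,
      whisker_comp p q _ _ hs hs hs]
  · have hm := merge_dot (W := W) p q 1 1 hs rfl
    have hd := dot_split (W := W) p q 1 1 hs rfl
    rw [hX]
    simp only [Preadditive.sub_comp, Preadditive.comp_sub, Category.assoc, Category.comp_id,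
      Category.id_comp]
    have h := congr($hm ≫ whisker p q (W.split 1 1) rfl hs)
    simp only [Category.assoc, Preadditive.add_comp] at h
    rw [hd, Preadditive.comp_add] at h
    linear_combination (norm := module) h

theorem whisker_congr_heq {x x' y y' s t : WObj} {f : W.Hom x y} {g : W.Hom x' y'} (hx : x = x')
    (hy : y = y') (hfg : HEq f g) (hs : p ++ x ++ q = s) (ht : p ++ y ++ q = t) :
    whisker p q f hs ht = whisker p q g (by rw [← hx, hs]) (by rw [← hy, ht]) := by
  subst hx hy hfg; rfl

theorem merge_assoc (h k l : ℕ) {s t u v : WObj} (hs : p ++ [h, k, l] ++ q = s)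
    (ht : p ++ [h + k, l] ++ q = t) (hu : p ++ [h, k + l] ++ q = u)
    (hv : p ++ [h + k + l] ++ q = v) :
    (whisker p (l :: q) (W.merge h k) (by simpa using hs) (by simpa using ht)
        ≫ whisker p q (W.merge (h + k) l) ht hv : (⟨s⟩ : Word W) ⟶ ⟨v⟩)
      = whisker (p ++ [h]) q (W.merge k l) (by simpa using hs) (by simpa using hu)
        ≫ whisker p q (W.merge h (k + l)) hu (by rw [← hv, add_assoc]) := by
  have e₁ : whisker (W := W) p q (x := [h, k, l]) (y := [h + k, l])
      (W.tensor (W.merge h k) (W.id [l])) hs ht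
      = whisker p (l :: q) (W.merge h k) (by simpa using hs) (by simpa using ht) :=
    whisker_tensor_id ..
  have e₂ : whisker (W := W) p q (x := [h, k, l]) (y := [h, k + l])
      (W.tensor (W.id [h]) (W.merge k l)) hs hu
      = whisker (p ++ [h]) q (W.merge k l) (by simpa using hs) (by simpa using hu) :=
    whisker_id_tensor ..
  rw [← e₁, ← e₂, ← whisker_comp, ← whisker_comp]
  exact whisker_congr_heq p q rfl (by rw [add_assoc]) (W.rel_merge_assoc h k l) hs hv

theorem split_assoc (h k l : ℕ) {s t u v : WObj} (hs : p ++ [h, k, l] ++ q = s)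
    (ht : p ++ [h + k, l] ++ q = t) (hu : p ++ [h, k + l] ++ q = u)
    (hv : p ++ [h + k + l] ++ q = v) :
    (whisker p q (W.split (h + k) l) hv ht
        ≫ whisker p (l :: q) (W.split h k) (by simpa using ht) (by simpa using hs) :
        (⟨v⟩ : Word W) ⟶ ⟨s⟩)
      = whisker p q (W.split h (k + l)) (by rw [← hv, add_assoc]) hu
        ≫ whisker (p ++ [h]) q (W.split k l) (by simpa using hu) (by simpa using hs) := by
  have e₁ : whisker (W := W) p q (x := [h + k, l]) (y := [h, k, l])
      (W.tensor (W.split h k) (W.id [l])) ht hs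
      = whisker p (l :: q) (W.split h k) (by simpa using ht) (by simpa using hs) :=
    whisker_tensor_id ..
  have e₂ : whisker (W := W) p q (x := [h, k + l]) (y := [h, k, l])
      (W.tensor (W.id [h]) (W.split k l)) hu hs
      = whisker (p ++ [h]) q (W.split k l) (by simpa using hu) (by simpa using hs) :=
    whisker_id_tensor ..
  rw [← e₁, ← e₂, ← whisker_comp, ← whisker_comp]
  exact whisker_congr_heq p q (by rw [add_assoc]) rfl (W.rel_split_assoc h k l) hv hs

/-- The crossing is invisible behind a merge with a `0`-strand followed by a dumbbell. -/
theorem cross_merge_zero {s t : WObj} (hs : p ++ [1, 1] ++ q = s)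
    (ht : p ++ [1, 1, 0] ++ q = t) :
    (whisker p (0 :: q) W.cross (by simpa using ht) (by simpa using ht)
        ≫ whisker (p ++ [1]) q (W.merge 1 0) (by simpa using ht) (by simpa using hs)
      + whisker p (0 :: q) W.cross (by simpa using ht) (by simpa using ht)
        ≫ whisker (p ++ [1]) q (W.merge 1 0) (by simpa using ht) (by simpa using hs)
        ≫ whisker p q W.cross hs hs : (⟨t⟩ : Word W) ⟶ ⟨s⟩)
    = whisker (p ++ [1]) q (W.merge 1 0) (by simpa using ht) (by simpa using hs)
      + whisker (p ++ [1]) q (W.merge 1 0) (by simpa using ht) (by simpa using hs)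
        ≫ whisker p q W.cross hs hs := by
  have hm := merge_assoc (W := W) p q 1 1 0 ht rfl hs rfl
  have hc := cross_merge (W := W) p (0 :: q) (by simpa using ht) (t := p ++ [2, 0] ++ q) (by simp)
  have h := congr(whisker p (0 :: q) W.cross (by simpa using ht) (by simpa using ht)
    ≫ $hm ≫ whisker p q (W.split 1 1) rfl hs)
  have h' := congr($hm ≫ whisker p q (W.split 1 1) rfl hs)
  simp only [Category.assoc, reassoc_of% hc] at h h'
  rw [whisker_cross p q hs rfl]
  simp only [Preadditive.comp_sub, Category.comp_id]
  linear_combination (norm := module) h' - h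

theorem split_cross_zero {s t : WObj} (hs : p ++ [1, 1] ++ q = s)
    (ht : p ++ [1, 1, 0] ++ q = t) :
    (whisker (p ++ [1]) q (W.split 1 0) (by simpa using hs) (by simpa using ht)
        ≫ whisker p (0 :: q) W.cross (by simpa using ht) (by simpa using ht)
      + whisker p q W.cross hs hs
        ≫ whisker (p ++ [1]) q (W.split 1 0) (by simpa using hs) (by simpa using ht)
        ≫ whisker p (0 :: q) W.cross (by simpa using ht) (by simpa using ht) :
        (⟨s⟩ : Word W) ⟶ ⟨t⟩)
    = whisker (p ++ [1]) q (W.split 1 0) (by simpa using hs) (by simpa using ht)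
      + whisker p q W.cross hs hs
        ≫ whisker (p ++ [1]) q (W.split 1 0) (by simpa using hs) (by simpa using ht) := by
  have hm := split_assoc (W := W) p q 1 1 0 ht rfl hs rfl
  have hc := split_cross (W := W) p (0 :: q) (by simpa using ht) (t := p ++ [2, 0] ++ q) (by simp)
  have h := congr(whisker p q (W.merge 1 1) hs rfl ≫ $hm
    ≫ whisker p (0 :: q) W.cross (by simpa using ht) (by simpa using ht))
  have h' := congr(whisker p q (W.merge 1 1) hs rfl ≫ $hm)
  simp only [Category.assoc, hc] at h h'
  rw [whisker_cross p q hs rfl]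
  simp only [Preadditive.sub_comp, Category.id_comp, Category.assoc]
  linear_combination (norm := module) h' - h

theorem square_switch {s : WObj} (hs : p ++ [2, 1] ++ q = s) :
    (whisker p (1 :: q) (W.split 1 1) (by simpa using hs) (t := p ++ [1, 1, 1] ++ q) (by simp)
        ≫ whisker (p ++ [1]) q (W.merge 1 1) (by simp) (t := p ++ [1, 2] ++ q) (by simp)
        ≫ whisker (p ++ [1]) q (W.split 1 1) (by simp) (t := p ++ [1, 1, 1] ++ q) (by simp)
        ≫ whisker p (1 :: q) (W.merge 1 1) (by simp) (by simpa using hs) : (⟨s⟩ : Word W) ⟶ ⟨s⟩)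
      = 𝟙 _ + whisker (p ++ [2]) q (W.split 1 0) (by simpa using hs) (t := p ++ [2, 1] ++ 0 :: q)
            (by simp)
          ≫ whisker p (0 :: q) (W.merge 2 1) (by simp) (t := p ++ [3] ++ 0 :: q) (by simp)
          ≫ whisker p (0 :: q) (W.split 2 1) (by simp) (t := p ++ [2, 1] ++ 0 :: q) (by simp)
          ≫ whisker (p ++ [2]) q (W.merge 1 0) (by simp) (by simpa using hs) := by
  have e₁ : whisker (W := W) p q (x := [2, 1]) (y := [1, 1, 1])
      (W.tensor (W.split 1 1) (W.id [1])) hs rfl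
      = whisker p (1 :: q) (W.split 1 1) (by simpa using hs) (by simp) := whisker_tensor_id ..
  have e₂ : whisker (W := W) p q (x := [1, 1, 1]) (y := [1, 2])
      (W.tensor (W.id [1]) (W.merge 1 1)) rfl rfl
      = whisker (p ++ [1]) q (W.merge 1 1) (by simp) (by simp) := whisker_id_tensor ..
  have e₃ : whisker (W := W) p q (x := [1, 2]) (y := [1, 1, 1])
      (W.tensor (W.id [1]) (W.split 1 1)) rfl rfl
      = whisker (p ++ [1]) q (W.split 1 1) (by simp) (by simp) := whisker_id_tensor ..
  have e₄ : whisker (W := W) p q (x := [1, 1, 1]) (y := [2, 1])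
      (W.tensor (W.merge 1 1) (W.id [1])) rfl hs
      = whisker p (1 :: q) (W.merge 1 1) (by simp) (by simpa using hs) := whisker_tensor_id ..
  have e₅ : whisker (W := W) p q (x := [2, 1]) (y := [2, 1, 0])
      (W.tensor (W.id [2]) (W.split 1 0)) hs (t := p ++ [2, 1] ++ 0 :: q) (by simp)
      = whisker (p ++ [2]) q (W.split 1 0) (by simpa using hs) (by simp) := whisker_id_tensor ..
  have e₆ : whisker (W := W) p q (x := [2, 1, 0]) (y := [3, 0])
      (W.tensor (W.merge 2 1) (W.id [0])) (s := p ++ [2, 1] ++ 0 :: q) (by simp)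
        (t := p ++ [3] ++ 0 :: q) (by simp)
      = whisker p (0 :: q) (W.merge 2 1) (by simp) (by simp) := whisker_tensor_id ..
  have e₇ : whisker (W := W) p q (x := [3, 0]) (y := [2, 1, 0])
      (W.tensor (W.split 2 1) (W.id [0])) (s := p ++ [3] ++ 0 :: q) (by simp)
        (t := p ++ [2, 1] ++ 0 :: q) (by simp)
      = whisker p (0 :: q) (W.split 2 1) (by simp) (by simp) := whisker_tensor_id ..
  have e₈ : whisker (W := W) p q (x := [2, 1, 0]) (y := [2, 1])
      (W.tensor (W.id [2]) (W.merge 1 0)) (s := p ++ [2, 1] ++ 0 :: q) (by simp) hs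
      = whisker (p ++ [2]) q (W.merge 1 0) (by simp) (by simpa using hs) := whisker_id_tensor ..
  have h : whisker (W := W) p q (x := [2, 1]) (y := [2, 1]) _ hs hs = _ :=
    congrArg (fun f => whisker (W := W) p q (x := [2, 1]) (y := [2, 1]) f hs hs)
      (W.rel_square_switch 1 0)
  simp only [whisker_sub, whisker_smul, whisker_id] at h
  rw [← e₁, ← e₂, ← e₃, ← e₄, ← e₅, ← e₆, ← e₇, ← e₈, ← sub_eq_iff_eq_add]
  simp only [← whisker_comp]
  refine Eq.trans ?_ (h.trans (by simp))
  simp only [W.comp_assoc]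

theorem dot_cross' {s : WObj} (hs : p ++ [1, 1] ++ q = s) :
    (whisker (p ++ [1]) q (W.dot 1) (by simpa using hs) (by simpa using hs)
        ≫ whisker p q W.cross hs hs : (⟨s⟩ : Word W) ⟶ ⟨s⟩)
      = whisker p q W.cross hs hs
        ≫ whisker p (1 :: q) (W.dot 1) (by simpa using hs) (by simpa using hs) := by
  have h := dot_cross (W := W) p q hs
  have hc := cross_cross (W := W) p q hs
  have := congr(whisker p q W.cross hs hs ≫ $h ≫ whisker p q W.cross hs hs)
  simpa [reassoc_of% hc, hc] using this.symm

/-- The web merging three strands and splitting them again. -/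
def dumbbellThree {s : WObj} (hs : p ++ [1, 1, 1] ++ q = s) : (⟨s⟩ : Word W) ⟶ ⟨s⟩ :=
  whisker p (1 :: q) (W.merge 1 1) (by simpa using hs) (t := p ++ [2, 1] ++ q) (by simp)
    ≫ whisker p q (W.merge 2 1) (by simp) (t := p ++ [3] ++ q) (by simp)
    ≫ whisker p q (W.split 2 1) (by simp) (t := p ++ [2, 1] ++ q) (by simp)
    ≫ whisker p (1 :: q) (W.split 1 1) (by simp) (by simpa using hs)

theorem cross_dumbbellThree {s : WObj} (hs : p ++ [1, 1, 1] ++ q = s) :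
    (whisker p (1 :: q) W.cross (by simpa using hs) (by simpa using hs) ≫ dumbbellThree p q hs :
      (⟨s⟩ : Word W) ⟶ ⟨s⟩) = dumbbellThree p q hs := by
  rw [dumbbellThree, ← Category.assoc, cross_merge]

theorem dumbbellThree_cross {s : WObj} (hs : p ++ [1, 1, 1] ++ q = s) :
    (dumbbellThree p q hs ≫ whisker p (1 :: q) W.cross (by simpa using hs) (by simpa using hs) :
      (⟨s⟩ : Word W) ⟶ ⟨s⟩) = dumbbellThree p q hs := by
  simp only [dumbbellThree, Category.assoc]
  rw [split_cross]

theorem cross_succ_dumbbellThree {s : WObj} (hs : p ++ [1, 1, 1] ++ q = s) :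
    (whisker (p ++ [1]) q W.cross (by simpa using hs) (by simpa using hs) ≫ dumbbellThree p q hs :
      (⟨s⟩ : Word W) ⟶ ⟨s⟩) = dumbbellThree p q hs := by
  have h := merge_assoc (W := W) p q 1 1 1 hs rfl rfl rfl
  have hc := cross_merge (W := W) (p ++ [1]) q (s := s) (by simpa using hs)
    (t := p ++ [1, 2] ++ q) (by simp)
  rw [dumbbellThree, reassoc_of% h, reassoc_of% hc]

theorem dumbbellThree_cross_succ {s : WObj} (hs : p ++ [1, 1, 1] ++ q = s) :
    (dumbbellThree p q hs ≫ whisker (p ++ [1]) q W.cross (by simpa using hs) (by simpa using hs) :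
      (⟨s⟩ : Word W) ⟶ ⟨s⟩) = dumbbellThree p q hs := by
  have h := split_assoc (W := W) p q 1 1 1 hs rfl rfl rfl
  have hc := split_cross (W := W) (p ++ [1]) q (s := s) (by simpa using hs)
    (t := p ++ [1, 2] ++ q) (by simp)
  rw [dumbbellThree, h]
  simp only [Category.assoc, hc]

theorem dumbbellThree_dot (k : ℕ) {s : WObj} (hs : p ++ [1, 1, 1] ++ k :: q = s) :
    (dumbbellThree p (k :: q) hs
        ≫ whisker (p ++ [1] ++ [1] ++ [1]) q (W.dot k) (by simpa using hs) (by simpa using hs) :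
      (⟨s⟩ : Word W) ⟶ ⟨s⟩)
      = whisker (p ++ [1] ++ [1] ++ [1]) q (W.dot k) (by simpa using hs) (by simpa using hs)
        ≫ dumbbellThree p (k :: q) hs := by
  let d₂ : (⟨p ++ [2, 1] ++ k :: q⟩ : Word W) ⟶ ⟨p ++ [2, 1] ++ k :: q⟩ :=
    whisker (p ++ [2] ++ [1]) q (W.dot k)
  let d₃ : (⟨p ++ [3] ++ k :: q⟩ : Word W) ⟶ ⟨p ++ [3] ++ k :: q⟩ := whisker (p ++ [3]) q (W.dot k)
  have h₁ : whisker p (1 :: k :: q) (W.split 1 1) (by simp) (by simpa using hs)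
      ≫ whisker (p ++ [1] ++ [1] ++ [1]) q (W.dot k) (by simpa using hs) (by simpa using hs)
      = d₂ ≫ whisker p (1 :: k :: q) (W.split 1 1) (by simp) (by simpa using hs) :=
    (whisker_interchange_of_mul_eq_zero [1] (W.par_split 1 1) (W.par_dot k) (by simp) ..).symm
  have h₂ : whisker p (k :: q) (W.split 2 1) ≫ d₂ = d₃ ≫ whisker p (k :: q) (W.split 2 1) :=
    (whisker_interchange_of_mul_eq_zero [] (W.par_split 2 1) (W.par_dot k) (by simp) ..).symm
  have h₃ : whisker p (k :: q) (W.merge 2 1) ≫ d₃ = d₂ ≫ whisker p (k :: q) (W.merge 2 1) :=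
    (whisker_interchange_of_mul_eq_zero [] (W.par_merge 2 1) (W.par_dot k) (by simp) ..).symm
  have h₄ : whisker p (1 :: k :: q) (W.merge 1 1) (by simpa using hs) (by simp) ≫ d₂
      = whisker (p ++ [1] ++ [1] ++ [1]) q (W.dot k) (by simpa using hs) (by simpa using hs)
        ≫ whisker p (1 :: k :: q) (W.merge 1 1) (by simpa using hs) (by simp) :=
    (whisker_interchange_of_mul_eq_zero [1] (W.par_merge 1 1) (W.par_dot k) (by simp) ..).symm
  simp only [dumbbellThree, Category.assoc]
  rw [h₁, reassoc_of% h₂, reassoc_of% h₃, reassoc_of% h₄]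

/-- Two square switches turn `aba - a`, for the dumbbells `a` and `b`, into a web through a
`0`-strand. -/
theorem cross_factorization {s t : WObj} (hs : p ++ [1, 1, 1] ++ q = s)
    (ht : p ++ [1, 1, 1, 0] ++ q = t) {S₁ S₂ : (⟨s⟩ : Word W) ⟶ ⟨s⟩}
    (h₁ : S₁ = whisker p (1 :: q) W.cross (by simpa using hs) (by simpa using hs))
    (h₂ : S₂ = whisker (p ++ [1]) q W.cross (by simpa using hs) (by simpa using hs)) :
    (𝟙 _ + S₁) ≫ (𝟙 _ + S₂) ≫ (𝟙 _ + S₁) - (𝟙 _ + S₁)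
      = whisker (p ++ [1] ++ [1]) q (W.split 1 0) (by simpa using hs) (by simpa using ht)
        ≫ dumbbellThree p (0 :: q) (by simpa using ht)
        ≫ whisker (p ++ [1] ++ [1]) q (W.merge 1 0) (by simpa using ht) (by simpa using hs) := by
  subst hs ht
  have hM : whisker (W := W) p (1 :: q) (W.merge 1 1) (s := p ++ [1, 1, 1] ++ q) (by simp)
      (t := p ++ [2, 1] ++ q) (by simp) ≫ whisker (p ++ [2]) q (W.split 1 0) (by simp)
      (t := p ++ [2, 1] ++ 0 :: q) (by simp)
      = whisker (p ++ [1] ++ [1]) q (W.split 1 0) (by simp) (t := p ++ [1, 1, 1, 0] ++ q) (by simp)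
        ≫ whisker p (1 :: 0 :: q) (W.merge 1 1) (by simp) (by simp) :=
    (whisker_interchange_of_mul_eq_zero [] (W.par_merge 1 1) (W.par_split 1 0) (by simp) ..).symm
  have hS : whisker (W := W) (p ++ [2]) q (W.merge 1 0) (s := p ++ [2, 1] ++ 0 :: q) (by simp)
      (t := p ++ [2, 1] ++ q) (by simp) ≫ whisker p (1 :: q) (W.split 1 1) (by simp)
      (t := p ++ [1, 1, 1] ++ q) (by simp)
      = whisker p (1 :: 0 :: q) (W.split 1 1) (by simp) (t := p ++ [1, 1, 1, 0] ++ q) (by simp)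
        ≫ whisker (p ++ [1] ++ [1]) q (W.merge 1 0) (by simp) (by simp) :=
    whisker_interchange_of_mul_eq_zero [] (W.par_split 1 1) (W.par_merge 1 0) (by simp) ..
  have hsq := square_switch (W := W) p q rfl
  rw [h₁, h₂, whisker_cross p (1 :: q) (by simp) (t := p ++ [2, 1] ++ q) (by simp),
    whisker_cross (p ++ [1]) q (by simp) (t := p ++ [1, 2] ++ q) (by simp)]
  simp only [add_sub_cancel, Category.assoc, dumbbellThree]
  rw [← hS, ← reassoc_of% hM]
  have h := congr(whisker (W := W) p (1 :: q) (W.merge 1 1) (s := p ++ [1, 1, 1] ++ q) (by simp)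
      (t := p ++ [2, 1] ++ q) (by simp) ≫ $hsq ≫ whisker p (1 :: q) (W.split 1 1) (by simp)
      (t := p ++ [1, 1, 1] ++ q) (by simp))
  simp only [Category.assoc, Preadditive.add_comp, Preadditive.comp_add, Category.id_comp] at h
  rw [h, add_sub_cancel_left]

theorem braid {s : WObj} (hs : p ++ [1, 1, 1] ++ q = s) {S₁ S₂ : (⟨s⟩ : Word W) ⟶ ⟨s⟩}
    (h₁ : S₁ = whisker p (1 :: q) W.cross (by simpa using hs) (by simpa using hs))
    (h₂ : S₂ = whisker (p ++ [1]) q W.cross (by simpa using hs) (by simpa using hs)) :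
    S₁ ≫ S₂ ≫ S₁ = S₂ ≫ S₁ ≫ S₂ := by
  obtain ⟨t, ht⟩ : ∃ t, p ++ [1, 1, 1, 0] ++ q = t := ⟨_, rfl⟩
  have hA := cross_factorization p q hs ht h₁ h₂
  have hS₁ : S₁ ≫ S₁ = 𝟙 _ := h₁ ▸ cross_cross ..
  have hS₂ : S₂ ≫ S₂ = 𝟙 _ := h₂ ▸ cross_cross ..
  let c₁ : (⟨s⟩ : Word W) ⟶ ⟨s⟩ :=
    whisker p (1 :: 1 :: q) (W.dot 1) (by simpa using hs) (by simpa using hs)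
  let c₂ : (⟨s⟩ : Word W) ⟶ ⟨s⟩ :=
    whisker (p ++ [1]) (1 :: q) (W.dot 1) (by simpa using hs) (by simpa using hs)
  let c₃ : (⟨s⟩ : Word W) ⟶ ⟨s⟩ :=
    whisker (p ++ [1] ++ [1]) q (W.dot 1) (by simpa using hs) (by simpa using hs)
  let c₂' : (⟨t⟩ : Word W) ⟶ ⟨t⟩ :=
    whisker (p ++ [1]) (1 :: 0 :: q) (W.dot 1) (by simpa using ht) (by simpa using ht)
  let c₃' : (⟨t⟩ : Word W) ⟶ ⟨t⟩ :=
    whisker (p ++ [1] ++ [1]) (0 :: q) (W.dot 1) (by simpa using ht) (by simpa using ht)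
  let d : (⟨t⟩ : Word W) ⟶ ⟨t⟩ :=
    whisker (p ++ [1] ++ [1] ++ [1]) q (W.dot 0) (by simpa using ht) (by simpa using ht)
  let S₁' : (⟨t⟩ : Word W) ⟶ ⟨t⟩ :=
    whisker p (1 :: 0 :: q) W.cross (by simpa using ht) (by simpa using ht)
  let S₂' : (⟨t⟩ : Word W) ⟶ ⟨t⟩ :=
    whisker (p ++ [1]) (0 :: q) W.cross (by simpa using ht) (by simpa using ht)
  set u : (⟨s⟩ : Word W) ⟶ ⟨t⟩ :=
    whisker (p ++ [1] ++ [1]) q (W.split 1 0) (by simpa using hs) (by simpa using ht) with hu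
  set F : (⟨t⟩ : Word W) ⟶ ⟨s⟩ :=
    whisker (p ++ [1] ++ [1]) q (W.merge 1 0) (by simpa using ht) (by simpa using hs) with hF
  have c₁S₁ : c₁ ≫ S₁ = S₁ ≫ c₂ := h₁ ▸ dot_cross ..
  have c₂S₁ : c₂ ≫ S₁ = S₁ ≫ c₁ := h₁ ▸ dot_cross' ..
  have c₃S₁ : c₃ ≫ S₁ = S₁ ≫ c₃ :=
    h₁ ▸ whisker_interchange_of_mul_eq_zero [] cross_mem_par (W.par_dot 1) (by simp) ..
  have c₁S₂ : c₁ ≫ S₂ = S₂ ≫ c₁ :=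
    h₂ ▸ (whisker_interchange_of_mul_eq_zero [] (W.par_dot 1) cross_mem_par (by simp) ..).symm
  have c₂S₂ : c₂ ≫ S₂ = S₂ ≫ c₃ := h₂ ▸ dot_cross ..
  have c₃S₂ : c₃ ≫ S₂ = S₂ ≫ c₂ := h₂ ▸ dot_cross' ..
  have c₂S₂' : c₂' ≫ S₂' = S₂' ≫ c₃' := dot_cross ..
  have c₃S₂' : c₃' ≫ S₂' = S₂' ≫ c₂' := dot_cross' ..
  have c₁c₁ : c₁ ≫ c₁ = 𝟙 _ := dot_dot ..
  have c₂c₂ : c₂ ≫ c₂ = 𝟙 _ := dot_dot ..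
  have c₃c₃ : c₃ ≫ c₃ = 𝟙 _ := dot_dot ..
  have c₂c₂' : c₂' ≫ c₂' = 𝟙 _ := dot_dot ..
  have c₃c₃' : c₃' ≫ c₃' = 𝟙 _ := dot_dot ..
  have c₂c₁ : c₂ ≫ c₁ = -(c₁ ≫ c₂) := dot_anticomm p (1 :: q) [] ..
  have c₃c₂ : c₃ ≫ c₂ = -(c₂ ≫ c₃) := dot_anticomm (p ++ [1]) q [] ..
  have c₃c₁ : c₃ ≫ c₁ = -(c₁ ≫ c₃) := dot_anticomm p q [1] ..
  have c₃c₂' : c₃' ≫ c₂' = -(c₂' ≫ c₃') := dot_anticomm (p ++ [1]) (0 :: q) [] ..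
  have dc₂ : d ≫ c₂' = -(c₂' ≫ d) := dot_anticomm (p ++ [1]) q [1] ..
  have dc₃ : d ≫ c₃' = -(c₃' ≫ d) := dot_anticomm (p ++ [1] ++ [1]) q [] ..
  have dS₁ : S₁' ≫ d = d ≫ S₁' :=
    (whisker_interchange_of_mul_eq_zero [1] cross_mem_par (W.par_dot 0) (by simp) ..).symm
  have dS₂ : S₂' ≫ d = d ≫ S₂' :=
    (whisker_interchange_of_mul_eq_zero [] cross_mem_par (W.par_dot 0) (by simp) ..).symm
  have Fc₂ : F ≫ c₂ = c₂' ≫ F :=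
    whisker_interchange_of_mul_eq_zero [] (W.par_dot 1) (W.par_merge 1 0) (by simp) ..
  have Fc₃ : F ≫ c₃ = c₃' ≫ F + d ≫ F := merge_dot ..
  have FS₁ : S₁' ≫ F = F ≫ S₁ :=
    h₁ ▸ (whisker_interchange_of_mul_eq_zero [] cross_mem_par (W.par_merge 1 0) (by simp) ..).symm
  have FS₂ : S₂' ≫ F + S₂' ≫ F ≫ S₂ = F + F ≫ S₂ :=
    h₂ ▸ cross_merge_zero (p ++ [1]) q _ (by simpa using ht)
  have uc₂ : c₂ ≫ u = u ≫ c₂' :=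
    (whisker_interchange_of_mul_eq_zero [] (W.par_dot 1) (W.par_split 1 0) (by simp) ..).symm
  have uc₃ : c₃ ≫ u = u ≫ c₃' + u ≫ d :=
    dot_split (p ++ [1] ++ [1]) q 1 0 (by simpa using ht) (by simpa using hs)
  have uS₁ : S₁ ≫ u = u ≫ S₁' :=
    h₁ ▸ (whisker_interchange_of_mul_eq_zero [] cross_mem_par (W.par_split 1 0) (by simp) ..).symm
  have uS₂ : u ≫ S₂' + S₂ ≫ u ≫ S₂' = u + S₂ ≫ u :=
    h₂ ▸ split_cross_zero (p ++ [1]) q _ (by simpa using ht)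
  have ht' : p ++ [1, 1, 1] ++ 0 :: q = t := by simpa using ht
  refine braid_of_invariant (δ := c₁ ≫ c₂ ≫ c₃) (ε := c₃ ≫ c₂ ≫ c₁) hS₁ hS₂ ?_ ?_ ?_ ?_
  · simp [c₃S₁, reassoc_of% c₂S₁, reassoc_of% c₁S₁, reassoc_of% c₂c₁]
  · simp [c₃S₂, reassoc_of% c₂S₂, reassoc_of% c₁S₂, c₃c₂]
  · simp [reassoc_of% c₃c₃, reassoc_of% c₂c₂, c₁c₁]
  refine invariant_of_factorization (k := c₂ - c₃) (l := c₁ - c₃) (k' := c₂' - c₃') (d := d)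
    (S₁' := S₁') (S₂' := S₂') hS₁ hS₂ ?_ ?_ ?_ ?_ ?_ (dot_zero_dot_zero ..) ?_ dS₁ dS₂ ?_ FS₁ FS₂
    ?_ uS₁ uS₂ (cross_dumbbellThree p (0 :: q) ht') (dumbbellThree_cross p (0 :: q) ht')
    (cross_succ_dumbbellThree p (0 :: q) ht') (dumbbellThree_cross_succ p (0 :: q) ht')
    (dumbbellThree_dot p q 0 ht') rfl hA
  · simp [c₂S₂, c₃S₂]
  · simp [c₂S₁, c₃S₁]
  · simp [c₁S₂, c₃S₂]
  · simp [c₂S₂', c₃S₂']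
  · simp only [Preadditive.sub_comp, Preadditive.comp_sub, c₂c₂', c₃c₃', c₃c₂']
    module
  · simp [dc₂, dc₃]
    module
  · simp [Fc₂, Fc₃]
    module
  · simp [uc₂, uc₃]
    module

end Generators

section Sergeev

variable {k i j : ℕ}

theorem oneW_succ' (n : ℕ) : oneW (n + 1) = 1 :: oneW n := List.replicate_succ

theorem sGen_eq_whisker {p q : WObj} (h : i + 2 ≤ k) (hp : oneW i = p) (hq : oneW (k - i - 2) = q)
    (hs : p ++ [1, 1] ++ q = oneW k) : sGen W k i = whisker p q W.cross hs hs := by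
  subst hp hq
  exact dif_pos h

theorem cGen_eq_whisker {p q : WObj} (h : i + 1 ≤ k) (hp : oneW i = p) (hq : oneW (k - i - 1) = q)
    (hs : p ++ [1] ++ q = oneW k) : cGen W k i = whisker p q (W.dot 1) hs hs := by
  subst hp hq
  exact dif_pos h

theorem sGen_sGen (hi : i + 2 ≤ k) : W.comp (sGen W k i) (sGen W k i) = W.id (oneW k) := by
  rw [sGen_eq_whisker hi rfl rfl (oneW_split2 (by omega))]
  exact cross_cross ..

theorem sGen_comm (hj : j + 2 ≤ k) (hij : i + 1 < j) :
    W.comp (sGen W k j) (sGen W k i) = W.comp (sGen W k i) (sGen W k j) := by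
  rw [sGen_eq_whisker (i := i) (by omega) rfl rfl (oneW_split2 (by omega)),
    sGen_eq_whisker hj rfl rfl (oneW_split2 (by omega))]
  exact whisker_interchange_of_mul_eq_zero (oneW (j - i - 2)) cross_mem_par cross_mem_par (by simp)
    _ _ _ _ _ _ _ _ (oneW_split2 (by omega)) (oneW_split2 (by omega)) (oneW_split2 (by omega))
    (oneW_split2 (by omega))

theorem sGen_cGen_comm_of_lt (hj : j + 1 ≤ k) (hij : i + 1 < j) :
    W.comp (sGen W k i) (cGen W k j) = W.comp (cGen W k j) (sGen W k i) := by
  rw [sGen_eq_whisker (by omega) rfl rfl (oneW_split2 (by omega)),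
    cGen_eq_whisker hj rfl rfl (oneW_split1 (by omega))]
  exact (whisker_interchange_of_mul_eq_zero (oneW (j - i - 2)) cross_mem_par (W.par_dot 1) (by simp)
    _ _ _ _ _ _ _ _ (oneW_split1 (by omega)) (oneW_split1 (by omega)) (oneW_split2 (by omega))
    (oneW_split2 (by omega))).symm

theorem sGen_cGen_comm_of_gt (hi : i + 2 ≤ k) (hij : j < i) :
    W.comp (sGen W k i) (cGen W k j) = W.comp (cGen W k j) (sGen W k i) := by
  rw [sGen_eq_whisker hi rfl rfl (oneW_split2 (by omega)),
    cGen_eq_whisker (i := j) (by omega) rfl rfl (oneW_split1 (by omega))]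
  exact whisker_interchange_of_mul_eq_zero (oneW (i - j - 1)) (W.par_dot 1) cross_mem_par (by simp)
    _ _ _ _ _ _ _ _ (oneW_split2 (by omega)) (oneW_split2 (by omega)) (oneW_split1 (by omega))
    (oneW_split1 (by omega))

theorem sGen_braid (hi : i + 3 ≤ k) :
    W.comp (sGen W k i) (W.comp (sGen W k (i + 1)) (sGen W k i))
      = W.comp (sGen W k (i + 1)) (W.comp (sGen W k i) (sGen W k (i + 1))) := by
  obtain ⟨n, rfl⟩ := Nat.exists_eq_add_of_le hi
  have hs : oneW i ++ [1, 1, 1] ++ oneW n = oneW (i + 3 + n) := by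
    simpa [oneW_succ'] using oneW_split2 (i := i) (j := n + 1) (k := i + 3 + n) (by omega)
  exact braid (oneW i) (oneW n) hs
    (sGen_eq_whisker (by omega) rfl
      (by rw [← oneW_succ', show i + 3 + n - i - 2 = n + 1 by omega]) _)
    (sGen_eq_whisker (by omega) (oneW_succ i)
      (by rw [show i + 3 + n - (i + 1) - 2 = n by omega]) _)

theorem cGen_sGen (hi : i + 2 ≤ k) :
    W.comp (cGen W k i) (sGen W k i) = W.comp (sGen W k i) (cGen W k (i + 1)) := by
  obtain ⟨n, rfl⟩ := Nat.exists_eq_add_of_le hi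
  have hs : oneW i ++ [1, 1] ++ oneW n = oneW (i + 2 + n) := oneW_split2 rfl
  rw [sGen_eq_whisker (p := oneW i) (q := oneW n) (by omega) rfl
      (by rw [show i + 2 + n - i - 2 = n by omega]) hs,
    cGen_eq_whisker (i := i) (p := oneW i) (q := 1 :: oneW n) (by omega) rfl
      (by rw [← oneW_succ', show i + 2 + n - i - 1 = n + 1 by omega]) (by simpa using hs),
    cGen_eq_whisker (i := i + 1) (p := oneW i ++ [1]) (q := oneW n) (by omega) (oneW_succ i)
      (by rw [show i + 2 + n - (i + 1) - 1 = n by omega]) (by simpa using hs)]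
  exact dot_cross ..

end Sergeev

end QWebUp

open QWebUp in
/-- Lemma 4.7 of Brown–Kujawa, "Webs of type Q".
For `k ≥ 2` let `s_i ∈ End(↑₁^k)` be the crossing of strands `i, i+1` (given by
`split_{1,1} ∘ merge_{1,1} − id` on those strands) and `c_i` the dot on strand
`i` (all indices 0-indexed, `i` admissible).  Then the Sergeev relations hold:
(1) `s_i² = id`; (2) `s_i s_j = s_j s_i` for `|i−j| > 1`;
(3) `s_i s_{i+1} s_i = s_{i+1} s_i s_{i+1}`; (4) `s_i c_j = c_j s_i` for
`|i−j| > 1`; (5) `s_i c_i = c_{i+1} s_i`.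
(`comp f g` is the diagrammatic composite "`f` then `g`", so the algebra
product `x y` of endomorphisms corresponds to `comp g f ↦ x ∘ y`.) -/
theorem qweb_sergeev_relations (W : QWebUp) (k : ℕ) (hk : 2 ≤ k) :
    (∀ i : ℕ, i + 2 ≤ k →
      W.comp (sGen W k i) (sGen W k i) = W.id (oneW k))
    ∧ (∀ i j : ℕ, i + 2 ≤ k → j + 2 ≤ k → (i + 1 < j ∨ j + 1 < i) →
      W.comp (sGen W k i) (sGen W k j) = W.comp (sGen W k j) (sGen W k i))
    ∧ (∀ i : ℕ, i + 3 ≤ k →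
      W.comp (sGen W k i) (W.comp (sGen W k (i + 1)) (sGen W k i))
        = W.comp (sGen W k (i + 1)) (W.comp (sGen W k i) (sGen W k (i + 1))))
    ∧ (∀ i j : ℕ, i + 2 ≤ k → j < k → (i + 1 < j ∨ j + 1 < i) →
      W.comp (sGen W k i) (cGen W k j) = W.comp (cGen W k j) (sGen W k i))
    ∧ (∀ i : ℕ, i + 2 ≤ k →
      W.comp (cGen W k i) (sGen W k i) = W.comp (sGen W k i) (cGen W k (i + 1))) := by
  refine ⟨fun i hi => sGen_sGen hi, fun i j hi hj hij => ?_, fun i hi => sGen_braid hi,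
    fun i j hi hj hij => ?_, fun i hi => cGen_sGen hi⟩
  · rcases hij with h | h
    · exact (sGen_comm hj h).symm
    · exact sGen_comm hi h
  · rcases hij with h | h
    · exact sGen_cGen_comm_of_lt hj h
    · exact sGen_cGen_comm_of_gt hi (by omega)
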